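/- arXiv:1103.5686 — 3 statements merged into one kernel-verified Lean document; each statement's English description precedes it below -/
import Mathlib

section
/- Ramsey theorem for increasing sequences of decreasing sequences: for all natural numbers a, b, r ≥ 1 and all permutations A : Equiv.Perm (Fin a) and B : Equiv.Perm (Fin b), each avoiding the patterns 231 and 312, there exist a natural number c and a permutation C : Equiv.Perm (Fin c) avoiding the patterns 231 and 312 such that for every coloring χ of the embeddings of A into C with r colors, there is an embedding g of B into C such that χ (g ∘ e) takes the same value for all embeddings e of A into B. -/
/-- An embedding of the permutation `α` into the permutation `γ`. -/
def PermEmbedding {a c : ℕ} (α : Equiv.Perm (Fin a)) (γ : Equiv.Perm (Fin c))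
    (f : Fin a → Fin c) : Prop :=
  StrictMono f ∧ ∀ i j : Fin a, α i < α j ↔ γ (f i) < γ (f j)

/-- `σ` contains the pattern 231. -/
def ContainsPattern231 {n : ℕ} (σ : Equiv.Perm (Fin n)) : Prop :=
  ∃ i j k : Fin n, i < j ∧ j < k ∧ σ k < σ i ∧ σ i < σ j

/-- `σ` contains the pattern 312. -/
def ContainsPattern312 {n : ℕ} (σ : Equiv.Perm (Fin n)) : Prop :=
  ∃ i j k : Fin n, i < j ∧ j < k ∧ σ j < σ k ∧ σ k < σ i

universe u

/-- For every `r`-coloring, the `d`-element subsets of a large enough set are constantly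
colored on some subset of size `n` (finite Ramsey theorem for hypergraphs). -/
def HasRamsey (r d : ℕ) : Prop :=
  ∀ n : ℕ, ∃ N : ℕ, ∀ (α : Type u) [LinearOrder α] (χ : Finset α → Fin r) (S : Finset α),
    N ≤ S.card → ∃ H ⊆ S, H.card = n ∧ ∃ k, ∀ T ⊆ H, T.card = d → χ T = k

/-- Large sets contain subsets of size `l` in which the color of a `(d + 1)`-element subset
depends only on its least element. -/
theorem HasRamsey.exists_color_of_min {r d : ℕ} (hr : 0 < r) (h : HasRamsey.{u} r d) (l : ℕ) :
    ∃ N : ℕ, ∀ (α : Type u) [LinearOrder α] (χ : Finset α → Fin r) (S : Finset α),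
      N ≤ S.card → ∃ H ⊆ S, H.card = l ∧ ∃ c : α → Fin r, ∀ x ∈ H, ∀ T ⊆ H, T.card = d →
        (∀ y ∈ T, x < y) → χ (insert x T) = c x := by
  induction l with
  | zero => exact ⟨0, fun α _ χ S _ => ⟨∅, by simp, by simp, fun _ => ⟨0, hr⟩, by simp⟩⟩
  | succ l ih =>
    obtain ⟨N, hN⟩ := ih
    obtain ⟨M, hM⟩ := h N
    refine ⟨M + 1, fun α _ χ S hS => ?_⟩
    have hne : S.Nonempty := Finset.card_pos.mp (by omega)
    set x := S.min' hne with hx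
    have hxS : x ∈ S := S.min'_mem hne
    obtain ⟨S', hS', hcard, k, hk⟩ := hM α (fun T => χ (insert x T)) (S.erase x)
      (by rw [Finset.card_erase_of_mem hxS]; omega)
    obtain ⟨H, hH, hHl, c, hc⟩ := hN α χ S' hcard.ge
    have hlt : ∀ y ∈ H, x < y := fun y hy => S.min'_lt_of_mem_erase_min' hne (hS' (hH hy))
    have hxH : x ∉ H := fun hmem => lt_irrefl _ (hlt x hmem)
    refine ⟨insert x H, ?_, by rw [Finset.card_insert_of_notMem hxH, hHl],
      Function.update c x k, ?_⟩
    · exact Finset.insert_subset hxS ((hH.trans hS').trans (Finset.erase_subset _ _))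
    · intro y hy T hT hTd hyT
      have hxy : x ≤ y := by
        rcases Finset.mem_insert.mp hy with rfl | hy
        · exact le_rfl
        · exact (hlt y hy).le
      have hTH : T ⊆ H := fun z hz =>
        Finset.mem_of_mem_insert_of_ne (hT hz) (hxy.trans_lt (hyT z hz)).ne'
      rcases Finset.mem_insert.mp hy with rfl | hy
      · rw [Function.update_self]
        exact hk T (hTH.trans hH) hTd
      · rw [Function.update_of_ne (hlt y hy).ne']
        exact hc y hy T hTH hTd hyT

/-- The finite Ramsey theorem for hypergraphs. -/
theorem hasRamsey {r : ℕ} (hr : 0 < r) (d : ℕ) : HasRamsey.{u} r d := by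
  induction d with
  | zero =>
    intro n
    refine ⟨n, fun α _ χ S hS => ?_⟩
    obtain ⟨H, hH, hn⟩ := Finset.exists_subset_card_eq hS
    exact ⟨H, hH, hn, χ ∅, fun T _ hT => by rw [Finset.card_eq_zero.mp hT]⟩
  | succ d ih =>
    intro n
    obtain ⟨N, hN⟩ := ih.exists_color_of_min hr (r * n)
    refine ⟨N, fun α _ χ S hS => ?_⟩
    obtain ⟨H, hH, hcard, c, hc⟩ := hN α χ S hS
    obtain ⟨k, -, hk⟩ := Finset.exists_le_card_fiber_of_mul_le_card_of_maps_to
      (s := H) (t := Finset.univ) (f := c) (n := n) (fun _ _ => Finset.mem_univ _)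
      ⟨⟨0, hr⟩, Finset.mem_univ _⟩ (by simp [hcard])
    obtain ⟨K, hK, hn⟩ := Finset.exists_subset_card_eq hk
    have hKH : K ⊆ H := hK.trans (Finset.filter_subset _ _)
    refine ⟨K, hKH.trans hH, hn, k, fun T hT hTd => ?_⟩
    have hne : T.Nonempty := Finset.card_pos.mp (by omega)
    have hmem := T.min'_mem hne
    have hmin := hc _ (hKH (hT hmem)) (T.erase (T.min' hne))
      ((Finset.erase_subset _ _).trans (hT.trans hKH))
      (by rw [Finset.card_erase_of_mem hmem]; omega)
      (fun y hy => T.min'_lt_of_mem_erase_min' hne hy)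
    rw [Finset.insert_erase hmem] at hmin
    rw [hmin]
    exact (Finset.mem_filter.mp (hK (hT hmem))).2

/-- In a permutation avoiding 231 and 312, each position can be assigned the first position of its
decreasing block. -/
theorem exists_blockStart {n : ℕ} (σ : Equiv.Perm (Fin n)) (h231 : ¬ ContainsPattern231 σ)
    (h312 : ¬ ContainsPattern312 σ) :
    ∃ s : Fin n → Fin n, (∀ x, s x ≤ x) ∧ (∀ x y, x < y → σ x < σ y → x < s y) ∧
      ∀ x y, x < y → σ y < σ x → s x = s y := by
  classical
  have hne (x : Fin n) : (Finset.univ.filter fun z => z ≤ x ∧ σ x ≤ σ z).Nonempty :=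
    ⟨x, by simp⟩
  refine ⟨fun x => Finset.min' _ (hne x), fun x => Finset.min'_le _ _ (by simp),
    fun x y hxy hσ => ?_, fun x y hxy hσ => ?_⟩
  · rw [Finset.lt_min'_iff]
    intro z hz
    simp only [Finset.mem_filter, Finset.mem_univ, true_and] at hz
    by_contra! hzx
    have hzne : z ≠ x := fun h => (hσ.trans_le hz.2).ne (by rw [h])
    have hyz : σ y ≠ σ z := fun h => (hzx.trans_lt hxy).ne (σ.injective h).symm
    exact h312 ⟨z, x, y, lt_of_le_of_ne hzx hzne, hxy, hσ, lt_of_le_of_ne hz.2 hyz⟩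
  · apply le_antisymm
    · refine Finset.le_min' _ _ _ fun z hz => ?_
      simp only [Finset.mem_filter, Finset.mem_univ, true_and] at hz
      rcases lt_or_ge x z with hxz | hzx
      · exact (Finset.min'_le _ x (by simp)).trans hxz.le
      · refine Finset.min'_le _ _ ?_
        simp only [Finset.mem_filter, Finset.mem_univ, true_and]
        refine ⟨hzx, ?_⟩
        by_contra! hlt
        have hzne : z ≠ x := fun h => hlt.ne (by rw [h])
        have hyz : σ y ≠ σ z := fun h => (hzx.trans_lt hxy).ne (σ.injective h).symm
        exact h231 ⟨z, x, y, lt_of_le_of_ne hzx hzne, hxy, lt_of_le_of_ne hz.2 hyz, hlt⟩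
    · refine Finset.min'_subset _ fun z hz => ?_
      simp only [Finset.mem_filter, Finset.mem_univ, true_and] at hz ⊢
      exact ⟨hz.1.trans hxy.le, hσ.le.trans hz.2⟩

theorem finProdFinEquiv_lt_iff {m n : ℕ} (p q : Fin m × Fin n) :
    finProdFinEquiv p < finProdFinEquiv q ↔ p.1 < q.1 ∨ p.1 = q.1 ∧ p.2 < q.2 := by
  rcases p with ⟨⟨i, hi⟩, ⟨j, hj⟩⟩
  rcases q with ⟨⟨i', hi'⟩, ⟨j', hj'⟩⟩
  simp only [Fin.lt_def, finProdFinEquiv_apply_val, Fin.mk.injEq]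
  rcases lt_trichotomy i i' with h | rfl | h
  · have := Nat.mul_le_mul_left n (Nat.succ_le_of_lt h)
    rw [Nat.mul_succ] at this
    omega
  · omega
  · have := Nat.mul_le_mul_left n (Nat.succ_le_of_lt h)
    rw [Nat.mul_succ] at this
    omega

/-- The increasing sequence of `N` decreasing sequences of length `N`. -/
def gridPerm (N : ℕ) : Equiv.Perm (Fin (N * N)) :=
  finProdFinEquiv.permCongr ((Equiv.refl (Fin N)).prodCongr Fin.revPerm)

theorem gridPerm_lt_iff {N : ℕ} (p q : Fin N × Fin N) :
    gridPerm N (finProdFinEquiv p) < gridPerm N (finProdFinEquiv q) ↔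
      p.1 < q.1 ∨ p.1 = q.1 ∧ q.2 < p.2 := by
  simp [gridPerm, Equiv.permCongr_apply, finProdFinEquiv_lt_iff]

theorem gridPerm_avoids231 (N : ℕ) : ¬ ContainsPattern231 (gridPerm N) := by
  rintro ⟨i, j, k, hij, hjk, hki, hσ⟩
  obtain ⟨i, rfl⟩ := finProdFinEquiv.surjective i
  obtain ⟨j, rfl⟩ := finProdFinEquiv.surjective j
  obtain ⟨k, rfl⟩ := finProdFinEquiv.surjective k
  rw [finProdFinEquiv_lt_iff] at hij hjk
  rw [gridPerm_lt_iff] at hki hσ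
  omega

theorem gridPerm_avoids312 (N : ℕ) : ¬ ContainsPattern312 (gridPerm N) := by
  rintro ⟨i, j, k, hij, hjk, hjk', hki⟩
  obtain ⟨i, rfl⟩ := finProdFinEquiv.surjective i
  obtain ⟨j, rfl⟩ := finProdFinEquiv.surjective j
  obtain ⟨k, rfl⟩ := finProdFinEquiv.surjective k
  rw [finProdFinEquiv_lt_iff] at hij hjk
  rw [gridPerm_lt_iff] at hjk' hki
  omega

/-- The map into the grid that sends `x` to block `h (2 * s x)`, position `h (2 * x + 1)`. -/
def gridMap {n N : ℕ} (s : Fin n → Fin n) (h : Fin (2 * n) → Fin N) (x : Fin n) : Fin (N * N) :=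
  finProdFinEquiv (h ⟨2 * s x, by omega⟩, h ⟨2 * x + 1, by omega⟩)

theorem permEmbedding_of_lt {a c : ℕ} {α : Equiv.Perm (Fin a)} {γ : Equiv.Perm (Fin c)}
    {f : Fin a → Fin c} (hf : StrictMono f)
    (h : ∀ i j, i < j → (α i < α j → γ (f i) < γ (f j)) ∧ (α j < α i → γ (f j) < γ (f i))) :
    PermEmbedding α γ f := by
  refine ⟨hf, fun i j => ?_⟩
  rcases lt_trichotomy i j with hij | rfl | hij
  · refine ⟨(h i j hij).1, fun hγ => ?_⟩
    rcases lt_trichotomy (α i) (α j) with hα | hα | hα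
    · exact hα
    · exact absurd (α.injective hα) hij.ne
    · exact absurd ((h i j hij).2 hα) hγ.asymm
  · simp
  · refine ⟨(h j i hij).2, fun hγ => ?_⟩
    rcases lt_trichotomy (α i) (α j) with hα | hα | hα
    · exact hα
    · exact absurd (α.injective hα) hij.ne'
    · exact absurd ((h j i hij).1 hα) hγ.asymm

theorem permEmbedding_gridMap {n N : ℕ} {σ : Equiv.Perm (Fin n)} {s : Fin n → Fin n}
    (hle : ∀ x, s x ≤ x) (hlt : ∀ x y, x < y → σ x < σ y → x < s y)
    (heq : ∀ x y, x < y → σ y < σ x → s x = s y) {h : Fin (2 * n) → Fin N} (hh : StrictMono h) :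
    PermEmbedding σ (gridPerm N) (gridMap s h) := by
  have hcase (x y : Fin n) (hxy : x < y) : σ x < σ y ∨ σ y < σ x :=
    lt_or_gt_of_ne fun h => hxy.ne (σ.injective h)
  have hfst (x y : Fin n) (hxy : x < y) (hσ : σ x < σ y) :
      h ⟨2 * s x, by omega⟩ < h ⟨2 * s y, by omega⟩ := by
    have h1 := hlt x y hxy hσ
    have h2 := hle x
    exact hh (Fin.mk_lt_mk.mpr (by omega))
  have hsnd (x y : Fin n) (hxy : x < y) :
      h ⟨2 * x + 1, by omega⟩ < h ⟨2 * y + 1, by omega⟩ :=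
    hh (Fin.mk_lt_mk.mpr (by omega))
  refine permEmbedding_of_lt (fun x y hxy => ?_) fun x y hxy => ⟨fun hσ => ?_, fun hσ => ?_⟩
  · rw [gridMap, gridMap, finProdFinEquiv_lt_iff]
    rcases hcase x y hxy with hσ | hσ
    · exact Or.inl (hfst x y hxy hσ)
    · exact Or.inr ⟨by simp only [heq x y hxy hσ], hsnd x y hxy⟩
  · rw [gridMap, gridMap, gridPerm_lt_iff]
    exact Or.inl (hfst x y hxy hσ)
  · rw [gridMap, gridMap, gridPerm_lt_iff]
    exact Or.inr ⟨by simp only [heq x y hxy hσ], hsnd x y hxy⟩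

/-- An embedding between permutations with block starts `s` and `s'` extends to a strictly
monotone map of the indices used by `gridMap`. -/
theorem exists_strictMono_gridMap {a b : ℕ} {A : Equiv.Perm (Fin a)} {B : Equiv.Perm (Fin b)}
    {s : Fin a → Fin a} {s' : Fin b → Fin b}
    (hle : ∀ x, s x ≤ x) (hlt : ∀ x y, x < y → A x < A y → x < s y)
    (heq : ∀ x y, x < y → A y < A x → s x = s y)
    (hle' : ∀ x, s' x ≤ x) (hlt' : ∀ x y, x < y → B x < B y → x < s' y)
    (heq' : ∀ x y, x < y → B y < B x → s' x = s' y)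
    {e : Fin a → Fin b} (he : PermEmbedding A B e) :
    ∃ t : Fin (2 * a) → Fin (2 * b), StrictMono t ∧
      ∀ (N : ℕ) (h : Fin (2 * b) → Fin N), gridMap s' h ∘ e = gridMap s (h ∘ t) := by
  have hcase (x y : Fin a) (hxy : x < y) : A x < A y ∨ A y < A x :=
    lt_or_gt_of_ne fun h => hxy.ne (A.injective h)
  have hblock (x : Fin a) : s (s x) = s x ∧ s' (e (s x)) = s' (e x) := by
    rcases (hle x).eq_or_lt with h | h
    · simp only [h, and_self]
    · have hA : A x < A (s x) :=
        (hcase _ _ h).resolve_left fun hA => lt_irrefl _ (hlt _ _ h hA)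
      exact ⟨heq _ _ h hA, heq' _ _ (he.1 h) ((he.2 _ _).mp hA)⟩
  set v : Fin a → Fin b := fun x => if s x = x then s' (e x) else e x with hv
  have hve (x : Fin a) : v x ≤ e x := by
    simp only [hv]
    split_ifs
    · exact hle' _
    · exact le_rfl
  have hev (x y : Fin a) (hxy : x < y) : e x < v y := by
    simp only [hv]
    split_ifs with hy
    · refine hlt' _ _ (he.1 hxy) ((he.2 _ _).mp ?_)
      refine (hcase x y hxy).resolve_right fun hA => ?_
      have := heq x y hxy hA
      exact (this.symm.trans_le (hle x)).not_gt (by rwa [hy])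
    · exact he.1 hxy
  refine ⟨fun i => if i.1 % 2 = 0 then ⟨2 * v ⟨i / 2, by omega⟩, by omega⟩
    else ⟨2 * e ⟨i / 2, by omega⟩ + 1, by omega⟩, fun i j hij => ?_, fun N h => ?_⟩
  · have hi := hve ⟨i / 2, by omega⟩
    have hj := hve ⟨j / 2, by omega⟩
    rw [Fin.lt_def] at hij
    rcases (Nat.div_le_div_right (c := 2) hij.le).eq_or_lt with h | h
    · simp only [h] at hi ⊢
      rw [if_pos (by omega), if_neg (by omega), Fin.mk_lt_mk]
      omega
    · have hlt := hev ⟨i / 2, by omega⟩ ⟨j / 2, by omega⟩ (Fin.mk_lt_mk.mpr h)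
      rw [Fin.lt_def]
      dsimp only
      split_ifs <;> dsimp only <;> omega
  · funext x
    have hodd : (2 * (x : ℕ) + 1) / 2 = x := by omega
    simp [gridMap, hv, hodd, (hblock x).1, (hblock x).2, Nat.add_mod]

/-- Ramsey theorem for increasing sequences of decreasing sequences,
i.e. permutations avoiding the patterns 231 and 312. -/
theorem ramsey_increasing_of_decreasing (a b r : ℕ) (ha : 1 ≤ a) (hb : 1 ≤ b) (hr : 1 ≤ r)
    (A : Equiv.Perm (Fin a)) (B : Equiv.Perm (Fin b))
    (hA231 : ¬ ContainsPattern231 A) (hA312 : ¬ ContainsPattern312 A)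
    (hB231 : ¬ ContainsPattern231 B) (hB312 : ¬ ContainsPattern312 B) :
    ∃ (c : ℕ) (C : Equiv.Perm (Fin c)),
      ¬ ContainsPattern231 C ∧ ¬ ContainsPattern312 C ∧
      ∀ χ : (Fin a → Fin c) → Fin r,
        ∃ g : Fin b → Fin c, PermEmbedding B C g ∧
          ∃ k : Fin r, ∀ e : Fin a → Fin b, PermEmbedding A B e → χ (g ∘ e) = k := by
  obtain ⟨s, hle, hlt, heq⟩ := exists_blockStart A hA231 hA312
  obtain ⟨s', hle', hlt', heq'⟩ := exists_blockStart B hB231 hB312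
  obtain ⟨N, hN⟩ := hasRamsey.{0} hr (2 * a) (2 * b)
  refine ⟨N * N, gridPerm N, gridPerm_avoids231 N, gridPerm_avoids312 N, fun χ => ?_⟩
  obtain ⟨H, -, hH, k, hk⟩ := hN (Fin N)
    (fun T => if hT : T.card = 2 * a then χ (gridMap s (T.orderEmbOfFin hT)) else ⟨0, hr⟩)
    Finset.univ (by simp)
  refine ⟨gridMap s' (H.orderEmbOfFin hH),
    permEmbedding_gridMap hle' hlt' heq' (H.orderEmbOfFin hH).strictMono, k, fun e he => ?_⟩
  obtain ⟨t, ht, hcomp⟩ := exists_strictMono_gridMap hle hlt heq hle' hlt' heq' he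
  have hmono : StrictMono (H.orderEmbOfFin hH ∘ t) := (H.orderEmbOfFin hH).strictMono.comp ht
  have hcard : (Finset.univ.image (H.orderEmbOfFin hH ∘ t)).card = 2 * a := by
    rw [Finset.card_image_of_injective _ hmono.injective, Finset.card_fin]
  have hT := hk (Finset.univ.image (H.orderEmbOfFin hH ∘ t))
    (Finset.image_subset_iff.mpr fun i _ => H.orderEmbOfFin_mem hH _) hcard
  rw [dif_pos hcard, ← Finset.orderEmbOfFin_unique hcard
    (fun i => Finset.mem_image_of_mem _ (Finset.mem_univ i)) hmono] at hT
  rw [hcomp, hT]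
end

section
/- Universality of snakes: every a-partite permutation on n points admits an a-partite embedding into the a-snake of length n. -/
/-- `(σ, π)` is an `a`-partite permutation on `n` points: the part map `π` is
monotone (so parts are consecutive intervals in the natural order), and the two
linear orders agree within each part. -/
def IsPartitePerm {a n : ℕ} (σ : Equiv.Perm (Fin n)) (π : Fin n → Fin a) : Prop :=
  Monotone π ∧ ∀ i j : Fin n, i < j → π i = π j → σ i < σ j

/-- An `a`-partite embedding of the `a`-partite permutation `(α, πA)` into
`(γ, πC)`: strictly monotone, part-preserving, and preserving/reflecting the
second linear order. -/
def PartiteEmbedding {a m n : ℕ} (α : Equiv.Perm (Fin m)) (πA : Fin m → Fin a)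
    (γ : Equiv.Perm (Fin n)) (πC : Fin n → Fin a) (f : Fin m → Fin n) : Prop :=
  StrictMono f ∧ (∀ i, πC (f i) = πA i) ∧ ∀ i j : Fin m, α i < α j ↔ γ (f i) < γ (f j)

/-- The permutation of the `a`-snake of length `ξ`: the point in natural
position `i * ξ + x` (with `0 ≤ i < a`, `0 ≤ x < ξ`) is sent to second-order
rank `x * a + i`. -/
def snakePerm (a ξ : ℕ) : Equiv.Perm (Fin (a * ξ)) :=
  finProdFinEquiv.symm.trans ((Equiv.prodComm (Fin a) (Fin ξ)).trans
    (finProdFinEquiv.trans (finCongr (Nat.mul_comm ξ a))))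

/-- The part map of the `a`-snake of length `ξ`: the point in natural position
`i * ξ + x` (with `0 ≤ i < a`, `0 ≤ x < ξ`) lies in part `i`. -/
def snakePart (a ξ : ℕ) : Fin (a * ξ) → Fin a :=
  fun p => (finProdFinEquiv.symm p).1

theorem finProdFinEquiv_lt_of_fst_lt {m n : ℕ} {p q : Fin m × Fin n} (h : p.1 < q.1) :
    finProdFinEquiv p < finProdFinEquiv q := by
  rw [Fin.lt_def, finProdFinEquiv_apply_val, finProdFinEquiv_apply_val]
  have hmul : n * (p.1 + 1 : ℕ) ≤ n * q.1 := Nat.mul_le_mul_left n h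
  have := p.2.isLt
  rw [Nat.mul_add] at hmul
  lia

theorem finProdFinEquiv_lt_of_snd_lt {m n : ℕ} {p q : Fin m × Fin n} (h₁ : p.1 = q.1)
    (h₂ : p.2 < q.2) : finProdFinEquiv p < finProdFinEquiv q := by
  rw [Fin.lt_def, finProdFinEquiv_apply_val, finProdFinEquiv_apply_val, h₁]
  exact Nat.add_lt_add_right h₂ _

theorem snakePart_finProdFinEquiv {a ξ : ℕ} (p : Fin a × Fin ξ) :
    snakePart a ξ (finProdFinEquiv p) = p.1 := by
  simp [snakePart]

theorem snakePerm_finProdFinEquiv {a ξ : ℕ} (p : Fin a × Fin ξ) :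
    snakePerm a ξ (finProdFinEquiv p) =
      finCongr (Nat.mul_comm ξ a) (finProdFinEquiv p.swap) := by
  simp [snakePerm]

/-- Universality of snakes: every `a`-partite permutation on `n` points admits
an `a`-partite embedding into the `a`-snake of length `n`. -/
theorem snake_universal (a n : ℕ) (σ : Equiv.Perm (Fin n)) (π : Fin n → Fin a)
    (h : IsPartitePerm σ π) :
    ∃ f : Fin n → Fin (a * n),
      PartiteEmbedding σ π (snakePerm a n) (snakePart a n) f := by
  refine ⟨fun i => finProdFinEquiv (π i, σ i), ?_, fun i => snakePart_finProdFinEquiv _, ?_⟩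
  · intro i j hij
    rcases (h.1 hij.le).lt_or_eq with hlt | heq
    · exact finProdFinEquiv_lt_of_fst_lt hlt
    · exact finProdFinEquiv_lt_of_snd_lt heq (h.2 i j hij heq)
  · have hmono : ∀ i j, σ i < σ j →
        snakePerm a n (finProdFinEquiv (π i, σ i)) < snakePerm a n (finProdFinEquiv (π j, σ j)) := by
      intro i j hij
      rw [snakePerm_finProdFinEquiv, snakePerm_finProdFinEquiv]
      exact finProdFinEquiv_lt_of_fst_lt (p := (σ i, π i)) (q := (σ j, π j)) hij
    refine fun i j => ⟨hmono i j, fun hlt => ?_⟩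
    by_contra! hle
    rcases hle.lt_or_eq with hji | heq
    · exact lt_asymm hlt (hmono j i hji)
    · rw [σ.injective heq] at hlt
      exact lt_irrefl _ hlt
end

section
/- Strong amalgamation property for permutations: for all permutations A : Equiv.Perm (Fin a), B : Equiv.Perm (Fin m), B' : Equiv.Perm (Fin m') and all embeddings f of A into B and f' of A into B', there exist a natural number n, a permutation C : Equiv.Perm (Fin n), and embeddings g of B into C and g' of B' into C such that g ∘ f = g' ∘ f' and Set.range g ∩ Set.range g' = Set.range (g ∘ f). -/
open Classical in
/-- Locates `x` among the values of `f`: for strictly monotone `f`, the result is `2 * i + 1` at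
`f i` and twice the number of values of `f` below `x` when `x` is not a value of `f`. -/
noncomputable def gapIndex {a m : ℕ} (f : Fin a → Fin m) (x : Fin m) : ℕ :=
  (Finset.univ.filter fun i => f i < x).card + (Finset.univ.filter fun i => f i ≤ x).card

theorem gapIndex_apply {a m : ℕ} {f : Fin a → Fin m} (hf : StrictMono f) (i : Fin a) :
    gapIndex f (f i) = 2 * i + 1 := by
  have h₁ : (Finset.univ.filter fun j => j < i) = Finset.Iio i := by ext; simp
  have h₂ : (Finset.univ.filter fun j => j ≤ i) = Finset.Iic i := by ext; simp
  simp only [gapIndex, hf.lt_iff_lt, hf.le_iff_le, h₁, h₂, Fin.card_Iio, Fin.card_Iic]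
  omega

theorem even_gapIndex {a m : ℕ} {f : Fin a → Fin m} {x : Fin m} (hx : x ∉ Set.range f) :
    Even (gapIndex f x) := by
  have h : ∀ i, f i ≤ x ↔ f i < x := fun i =>
    ⟨fun h => h.lt_of_ne fun e => hx ⟨i, e⟩, le_of_lt⟩
  simp only [gapIndex, h]
  exact ⟨_, rfl⟩

theorem gapIndex_mono {a m : ℕ} (f : Fin a → Fin m) : Monotone (gapIndex f) := by
  intro x y h
  refine Nat.add_le_add (Finset.card_le_card ?_) (Finset.card_le_card ?_) <;>
    refine Finset.monotone_filter_right _ fun i _ hi => ?_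
  · exact lt_of_lt_of_le hi h
  · exact le_trans hi h

theorem mem_range_iff_odd_gapIndex {a m : ℕ} {f : Fin a → Fin m} (hf : StrictMono f)
    {x : Fin m} : x ∈ Set.range f ↔ Odd (gapIndex f x) := by
  refine ⟨?_, fun h => by_contra fun hx => Nat.not_even_iff_odd.2 h (even_gapIndex hx)⟩
  rintro ⟨i, rfl⟩
  exact ⟨i, gapIndex_apply hf i⟩

theorem eq_of_gapIndex_eq {a m : ℕ} {f : Fin a → Fin m} (hf : StrictMono f) {x y : Fin m}
    (hx : x ∈ Set.range f) (h : gapIndex f x = gapIndex f y) : x = y := by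
  obtain ⟨j, rfl⟩ : y ∈ Set.range f := by
    rwa [mem_range_iff_odd_gapIndex hf, ← h, ← mem_range_iff_odd_gapIndex hf]
  obtain ⟨i, rfl⟩ := hx
  rw [gapIndex_apply hf, gapIndex_apply hf] at h
  exact congrArg f (Fin.ext (by omega))

open Classical in
/-- A position for `x` in an amalgam of linear orders over the values of `f`. Values of `f` are
placed independently of `f`, other elements are shifted by `c` within their gap. -/
noncomputable def amalgamKey {a m : ℕ} (f : Fin a → Fin m) (c : ℕ) (x : Fin m) : ℕ ×ₗ ℕ :=
  toLex (gapIndex f x, if x ∈ Set.range f then 0 else c + x)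

theorem amalgamKey_strictMono {a m : ℕ} {f : Fin a → Fin m} (hf : StrictMono f) (c : ℕ) :
    StrictMono (amalgamKey f c) := by
  intro x y h
  rw [amalgamKey, amalgamKey, Prod.Lex.toLex_lt_toLex]
  rcases (gapIndex_mono f h.le).lt_or_eq with hlt | heq
  · exact Or.inl hlt
  · have hx : x ∉ Set.range f := fun hx => h.ne (eq_of_gapIndex_eq hf hx heq)
    have hy : y ∉ Set.range f := fun hy => h.ne' (eq_of_gapIndex_eq hf hy heq.symm)
    refine Or.inr ⟨heq, ?_⟩
    simpa only [if_neg hx, if_neg hy, Nat.add_lt_add_iff_left, Fin.val_fin_lt] using h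

theorem amalgamKey_eq_iff {a m m' : ℕ} {f : Fin a → Fin m} {f' : Fin a → Fin m'}
    (hf : StrictMono f) (hf' : StrictMono f') (x : Fin m) (y : Fin m') :
    amalgamKey f 0 x = amalgamKey f' m y ↔ ∃ i, f i = x ∧ f' i = y := by
  constructor
  · intro h
    obtain ⟨h₁, h₂⟩ := Prod.ext_iff.1 (toLex.injective h)
    dsimp only at h₁ h₂
    have hxy : x ∈ Set.range f ↔ y ∈ Set.range f' := by
      rw [mem_range_iff_odd_gapIndex hf, mem_range_iff_odd_gapIndex hf', h₁]
    by_cases hx : x ∈ Set.range f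
    · obtain ⟨j, rfl⟩ := hxy.1 hx
      obtain ⟨i, rfl⟩ := hx
      rw [gapIndex_apply hf, gapIndex_apply hf'] at h₁
      obtain rfl : i = j := Fin.ext (by omega)
      exact ⟨i, rfl, rfl⟩
    · rw [if_neg hx, if_neg (mt hxy.2 hx)] at h₂
      omega
  · rintro ⟨i, rfl, rfl⟩
    simp [amalgamKey, gapIndex_apply hf, gapIndex_apply hf']

/-- The enumeration of a finite type in the order induced by an injection. -/
theorem exists_equiv_fin_lt_iff {T L : Type*} [Finite T] [LinearOrder L] {p : T → L}
    (hp : p.Injective) : ∃ e : T ≃ Fin (Nat.card T), ∀ s t, e s < e t ↔ p s < p t := by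
  let := Fintype.ofFinite T
  let := LinearOrder.lift' p hp
  let e := Fintype.orderIsoFinOfCardEq T (Nat.card_eq_fintype_card (α := T)).symm
  exact ⟨e.symm.toEquiv, fun s t => e.symm.lt_iff_lt⟩

/-- A finite type with injections into two linear orders is a finite permutation. -/
theorem exists_perm_of_injective {T L L' : Type*} [Finite T] [LinearOrder L] [LinearOrder L']
    {p : T → L} {q : T → L'} (hp : p.Injective) (hq : q.Injective) :
    ∃ (n : ℕ) (C : Equiv.Perm (Fin n)) (e : T ≃ Fin n),
      (∀ s t, e s < e t ↔ p s < p t) ∧ ∀ s t, C (e s) < C (e t) ↔ q s < q t := by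
  obtain ⟨e, he⟩ := exists_equiv_fin_lt_iff hp
  obtain ⟨e', he'⟩ := exists_equiv_fin_lt_iff hq
  exact ⟨_, e.symm.trans e', e, he, by simpa using he'⟩

/-- In the second order, `f` is a strictly monotone map between the sets of values. -/
theorem PermEmbedding.strictMono_conj {a c : ℕ} {α : Equiv.Perm (Fin a)}
    {γ : Equiv.Perm (Fin c)} {f : Fin a → Fin c} (hf : PermEmbedding α γ f) :
    StrictMono (γ ∘ f ∘ α.symm) := by
  intro i j h
  exact (hf.2 _ _).1 (by simpa using h)

/-- Strong amalgamation property for the class of all finite permutations: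
the images of `B` and `B'` in `C` intersect exactly in the image of `A`. -/
theorem strong_amalgamation_permutations (a m m' : ℕ)
    (A : Equiv.Perm (Fin a)) (B : Equiv.Perm (Fin m)) (B' : Equiv.Perm (Fin m'))
    (f : Fin a → Fin m) (hf : PermEmbedding A B f)
    (f' : Fin a → Fin m') (hf' : PermEmbedding A B' f') :
    ∃ (n : ℕ) (C : Equiv.Perm (Fin n)) (g : Fin m → Fin n) (g' : Fin m' → Fin n),
      PermEmbedding B C g ∧ PermEmbedding B' C g' ∧
      g ∘ f = g' ∘ f' ∧
      Set.range g ∩ Set.range g' = Set.range (g ∘ f) := by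
  let u : Fin m → (ℕ ×ₗ ℕ) × (ℕ ×ₗ ℕ) := fun x =>
    (amalgamKey f 0 x, amalgamKey (B ∘ f ∘ A.symm) 0 (B x))
  let v : Fin m' → (ℕ ×ₗ ℕ) × (ℕ ×ₗ ℕ) := fun y =>
    (amalgamKey f' m y, amalgamKey (B' ∘ f' ∘ A.symm) m (B' y))
  have hu₁ : StrictMono fun x => (u x).1 := amalgamKey_strictMono hf.1 _
  have hv₁ : StrictMono fun y => (v y).1 := amalgamKey_strictMono hf'.1 _
  have hu₂ : ∀ x y, (u x).2 < (u y).2 ↔ B x < B y := fun _ _ =>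
    (amalgamKey_strictMono hf.strictMono_conj _).lt_iff_lt
  have hv₂ : ∀ x y, (v x).2 < (v y).2 ↔ B' x < B' y := fun _ _ =>
    (amalgamKey_strictMono hf'.strictMono_conj _).lt_iff_lt
  have hu₂' : Function.Injective fun x => (u x).2 :=
    (amalgamKey_strictMono hf.strictMono_conj _).injective.comp B.injective
  have hv₂' : Function.Injective fun x => (v x).2 :=
    (amalgamKey_strictMono hf'.strictMono_conj _).injective.comp B'.injective
  have huv₁ : ∀ x y, (u x).1 = (v y).1 ↔ ∃ i, f i = x ∧ f' i = y :=
    amalgamKey_eq_iff hf.1 hf'.1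
  have huv₂ : ∀ x y, (u x).2 = (v y).2 ↔ ∃ i, f i = x ∧ f' i = y := by
    intro x y
    refine (amalgamKey_eq_iff hf.strictMono_conj hf'.strictMono_conj _ _).trans ?_
    simp only [Function.comp_apply, B.apply_eq_iff_eq, B'.apply_eq_iff_eq]
    exact A.symm.exists_congr_left.trans (by simp)
  have huv : ∀ x y, u x = v y ↔ ∃ i, f i = x ∧ f' i = y := fun x y => by
    rw [Prod.ext_iff, huv₁, huv₂, and_self_iff]
  let T := ↥(Set.range u ∪ Set.range v)
  have hp : Function.Injective fun t : T => t.1.1 := by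
    rintro ⟨_, ⟨x, rfl⟩ | ⟨x, rfl⟩⟩ ⟨_, ⟨y, rfl⟩ | ⟨y, rfl⟩⟩ h <;> refine Subtype.ext ?_
    · exact congrArg u (hu₁.injective h)
    · exact (huv _ _).2 ((huv₁ _ _).1 h)
    · exact ((huv _ _).2 ((huv₁ _ _).1 h.symm)).symm
    · exact congrArg v (hv₁.injective h)
  have hq : Function.Injective fun t : T => t.1.2 := by
    rintro ⟨_, ⟨x, rfl⟩ | ⟨x, rfl⟩⟩ ⟨_, ⟨y, rfl⟩ | ⟨y, rfl⟩⟩ h <;> refine Subtype.ext ?_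
    · exact congrArg u (hu₂' h)
    · exact (huv _ _).2 ((huv₂ _ _).1 h)
    · exact ((huv _ _).2 ((huv₂ _ _).1 h.symm)).symm
    · exact congrArg v (hv₂' h)
  obtain ⟨n, C, e, he, he'⟩ := exists_perm_of_injective hp hq
  let g : Fin m → Fin n := fun x => e ⟨u x, Or.inl (Set.mem_range_self x)⟩
  let g' : Fin m' → Fin n := fun y => e ⟨v y, Or.inr (Set.mem_range_self y)⟩
  have hg : ∀ x y, g x = g' y ↔ ∃ i, f i = x ∧ f' i = y := fun x y =>
    e.apply_eq_iff_eq.trans (Subtype.ext_iff.trans (huv x y))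
  have hgf : g ∘ f = g' ∘ f' := funext fun i => (hg _ _).2 ⟨i, rfl, rfl⟩
  refine ⟨n, C, g, g', ⟨fun x y h => (he _ _).2 (hu₁ h), fun x y => ?_⟩,
    ⟨fun x y h => (he _ _).2 (hv₁ h), fun x y => ?_⟩, hgf, ?_⟩
  · exact ((he' _ _).trans (hu₂ x y)).symm
  · exact ((he' _ _).trans (hv₂ x y)).symm
  · refine Set.Subset.antisymm ?_ (Set.subset_inter (Set.range_comp_subset_range f g) ?_)
    · rintro _ ⟨⟨x, rfl⟩, y, h⟩
      obtain ⟨i, rfl, -⟩ := (hg x y).1 h.symm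
      exact ⟨i, rfl⟩
    · exact hgf ▸ Set.range_comp_subset_range f' g'
end
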